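/- Consider two coupled agents ẋ₁ = f(x₁,t) + c Γ (x₂ − x₁) + c_d Γ_d sign(x₂ − x₁) and ẋ₂ = f(x₂,t) + c Γ (x₁ − x₂) + c_d Γ_d sign(x₁ − x₂), where sign acts componentwise. Assume there exist P, Q ∈ ℝⁿˣⁿ and m ∈ ℝⁿ, with P symmetric positive definite and m ≠ 0, such that: f satisfies the relaxed QUAD condition with P, Q, m; sym(PΓ) is positive definite; PΓ_d = diag(γ_{d,1},…,γ_{d,n}) with γ_{d,h} ≥ 0 for all h and γ_{d,h} > 0 whenever m_h > 0. If c > ‖Q‖ / (2 λ_min(sym(PΓ))) and c_d ≥ 0 satisfies m_h − 2 c_d γ_{d,h} ≤ 0 for every h = 1,…,n, then the pair globally synchronizes: for every solution (locally absolutely continuous x₁, x₂ : [0,∞) → ℝⁿ satisfying the equations for almost every t), ‖x₁(t) − x₂(t)‖ → 0 as t → ∞. -/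

import Mathlib

open Matrix MeasureTheory
open scoped Kronecker

/-- Euclidean norm of a finite-dimensional real vector. -/
noncomputable def euclNorm {k : Type*} [Fintype k] (v : k → ℝ) : ℝ :=
  Real.sqrt (∑ i, (v i) ^ 2)

/-- Smallest eigenvalue of a symmetric matrix, via Rayleigh quotients. -/
noncomputable def lambdaMin {n : ℕ} (G : Matrix (Fin n) (Fin n) ℝ) : ℝ :=
  sInf {r : ℝ | ∃ v : Fin n → ℝ, v ≠ 0 ∧ v ⬝ᵥ G.mulVec v = r * ∑ i, (v i) ^ 2}

/-- Largest eigenvalue of a symmetric matrix, via Rayleigh quotients. -/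
noncomputable def lambdaMax {n : ℕ} (G : Matrix (Fin n) (Fin n) ℝ) : ℝ :=
  sSup {r : ℝ | ∃ v : Fin n → ℝ, v ≠ 0 ∧ v ⬝ᵥ G.mulVec v = r * ∑ i, (v i) ^ 2}

/-- Second-smallest eigenvalue of a connected-graph Laplacian, via Rayleigh
quotients over the zero-sum subspace (Courant–Fischer). -/
noncomputable def lambda2 {N : ℕ} (L : Matrix (Fin N) (Fin N) ℝ) : ℝ :=
  sInf {r : ℝ | ∃ v : Fin N → ℝ, v ≠ 0 ∧ (∑ i, v i) = 0 ∧
    v ⬝ᵥ L.mulVec v = r * ∑ i, (v i) ^ 2}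

/-- Spectral (ℓ²-operator) norm of a square matrix. -/
noncomputable def specNorm {n : ℕ} (Q : Matrix (Fin n) (Fin n) ℝ) : ℝ :=
  sSup {r : ℝ | ∃ v : Fin n → ℝ, euclNorm v = 1 ∧ r = euclNorm (Q.mulVec v)}

/-- `L` is the Laplacian matrix of a connected undirected graph: symmetric,
positive semidefinite, zero row sums, and `λ₂(L) > 0`. -/
def IsLaplacianConnected {N : ℕ} (L : Matrix (Fin N) (Fin N) ℝ) : Prop :=
  L.IsSymm ∧ (∀ v : Fin N → ℝ, 0 ≤ v ⬝ᵥ L.mulVec v) ∧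
    (∀ i, ∑ j, L i j = 0) ∧ 0 < lambda2 L

/-- The QUAD(P,Q) condition. -/
def QUAD {n : ℕ} (P Q : Matrix (Fin n) (Fin n) ℝ)
    (f : (Fin n → ℝ) → ℝ → (Fin n → ℝ)) : Prop :=
  ∀ x y : Fin n → ℝ, ∀ t : ℝ, 0 ≤ t →
    (x - y) ⬝ᵥ P.mulVec (f x t - f y t) ≤ (x - y) ⬝ᵥ Q.mulVec (x - y)

/-- The relaxed QUAD condition with matrices `P`, `Q` and vector `m`. -/
def RelaxedQUAD {n : ℕ} (P Q : Matrix (Fin n) (Fin n) ℝ) (m : Fin n → ℝ)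
    (f : (Fin n → ℝ) → ℝ → (Fin n → ℝ)) : Prop :=
  ∀ x y : Fin n → ℝ, ∀ t : ℝ, 0 ≤ t →
    (x - y) ⬝ᵥ P.mulVec (f x t - f y t) ≤
      (x - y) ⬝ᵥ Q.mulVec (x - y) + ∑ h, m h * |x h - y h|

/-- The coupling assumption on `g` with matrices `P`, `G` and gain `c`. -/
def CouplingAssumption {n : ℕ} (P G : Matrix (Fin n) (Fin n) ℝ) (c : ℝ)
    (g : (Fin n → ℝ) → (Fin n → ℝ) → ℝ → (Fin n → ℝ)) : Prop :=
  (∀ x : Fin n → ℝ, ∀ t : ℝ, 0 ≤ t → g x x t = 0) ∧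
  (∀ x y : Fin n → ℝ, ∀ t : ℝ, 0 ≤ t → g x y t = - g y x t) ∧
  (∀ x y : Fin n → ℝ, ∀ t : ℝ, 0 ≤ t →
    c * ((x - y) ⬝ᵥ G.mulVec (x - y)) ≤ (y - x) ⬝ᵥ P.mulVec (g x y t))

/-- Symmetric part of a matrix. -/
noncomputable def symPart {n : ℕ} (M : Matrix (Fin n) (Fin n) ℝ) :
    Matrix (Fin n) (Fin n) ℝ := (1 / 2 : ℝ) • (M + M.transpose)

/-- Componentwise sign of a vector, with `sign 0 = 0`. -/
noncomputable def signVec {n : ℕ} (v : Fin n → ℝ) : Fin n → ℝ :=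
  fun h => Real.sign (v h)

lemma euclNorm_nonneg {k : Type*} [Fintype k] (v : k → ℝ) : 0 ≤ euclNorm v := Real.sqrt_nonneg _

lemma euclNorm_sq {k : Type*} [Fintype k] (v : k → ℝ) : euclNorm v ^ 2 = ∑ i, v i ^ 2 :=
  Real.sq_sqrt (Finset.sum_nonneg fun _ _ => sq_nonneg _)

lemma euclNorm_smul {k : Type*} [Fintype k] (a : ℝ) (v : k → ℝ) :
    euclNorm (a • v) = |a| * euclNorm v := by
  simp only [euclNorm, Pi.smul_apply, smul_eq_mul, mul_pow, ← Finset.mul_sum]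
  rw [Real.sqrt_mul (sq_nonneg a), Real.sqrt_sq_eq_abs]

lemma sum_sq_pos_of_ne_zero {k : Type*} [Fintype k] {v : k → ℝ} (hv : v ≠ 0) :
    0 < ∑ i, v i ^ 2 := by
  obtain ⟨i, hi⟩ := Function.ne_iff.mp hv
  exact Finset.sum_pos' (fun _ _ => sq_nonneg _)
    ⟨i, Finset.mem_univ i, by simpa using sq_pos_of_ne_zero hi⟩

lemma euclNorm_pos_of_ne_zero {k : Type*} [Fintype k] {v : k → ℝ} (hv : v ≠ 0) :
    0 < euclNorm v :=
  Real.sqrt_pos.mpr (sum_sq_pos_of_ne_zero hv)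

/-- Cauchy–Schwarz for `euclNorm`. -/
lemma dotProduct_le_euclNorm_mul {k : Type*} [Fintype k] (v w : k → ℝ) :
    v ⬝ᵥ w ≤ euclNorm v * euclNorm w :=
  Real.sum_mul_le_sqrt_mul_sqrt _ _ _

lemma euclNorm_mulVec_le_frobenius {n : ℕ} (M : Matrix (Fin n) (Fin n) ℝ) (v : Fin n → ℝ) :
    euclNorm (M *ᵥ v) ≤ Real.sqrt (∑ i, ∑ j, M i j ^ 2) * euclNorm v := by
  unfold euclNorm
  rw [← Real.sqrt_mul (by positivity), Finset.sum_mul]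
  refine Real.sqrt_le_sqrt (Finset.sum_le_sum fun i _ => ?_)
  exact Finset.sum_mul_sq_le_sq_mul_sq Finset.univ (M i) v

lemma bddAbove_specNorm_set {n : ℕ} (M : Matrix (Fin n) (Fin n) ℝ) :
    BddAbove {r : ℝ | ∃ v : Fin n → ℝ, euclNorm v = 1 ∧ r = euclNorm (M *ᵥ v)} := by
  refine ⟨Real.sqrt (∑ i, ∑ j, M i j ^ 2), ?_⟩
  rintro r ⟨v, hv, rfl⟩
  simpa [hv] using euclNorm_mulVec_le_frobenius M v

lemma specNorm_nonneg {n : ℕ} (M : Matrix (Fin n) (Fin n) ℝ) : 0 ≤ specNorm M := by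
  apply Real.sSup_nonneg
  rintro r ⟨v, -, rfl⟩
  exact euclNorm_nonneg _

lemma euclNorm_mulVec_le {n : ℕ} (M : Matrix (Fin n) (Fin n) ℝ) (v : Fin n → ℝ) :
    euclNorm (M *ᵥ v) ≤ specNorm M * euclNorm v := by
  rcases eq_or_ne v 0 with rfl | hv
  · simp [euclNorm]
  have hpos := euclNorm_pos_of_ne_zero hv
  have h : euclNorm (M *ᵥ ((euclNorm v)⁻¹ • v)) ≤ specNorm M := by
    refine le_csSup (bddAbove_specNorm_set M) ⟨(euclNorm v)⁻¹ • v, ?_, rfl⟩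
    rw [euclNorm_smul, abs_of_pos (inv_pos.mpr hpos), inv_mul_cancel₀ hpos.ne']
  rwa [mulVec_smul, euclNorm_smul, abs_of_pos (inv_pos.mpr hpos), inv_mul_le_iff₀ hpos,
    mul_comm] at h

lemma dotProduct_mulVec_le_specNorm {n : ℕ} (M : Matrix (Fin n) (Fin n) ℝ) (v : Fin n → ℝ) :
    v ⬝ᵥ M *ᵥ v ≤ specNorm M * ∑ i, v i ^ 2 := by
  rw [← euclNorm_sq]
  nlinarith [dotProduct_le_euclNorm_mul v (M *ᵥ v),
    mul_le_mul_of_nonneg_left (euclNorm_mulVec_le M v) (euclNorm_nonneg v)]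

lemma Matrix.PosDef.exists_pos_mul_sum_sq_le {n : ℕ} {M : Matrix (Fin n) (Fin n) ℝ}
    (hM : M.PosDef) : ∃ l > 0, ∀ v : Fin n → ℝ, l * ∑ i, v i ^ 2 ≤ v ⬝ᵥ M *ᵥ v := by
  have hq : ∀ v : Fin n → ℝ, v ≠ 0 → 0 < v ⬝ᵥ M *ᵥ v := fun v hv => by
    simpa using hM.dotProduct_mulVec_pos hv
  have hne : ∀ v ∈ Metric.sphere (0 : Fin n → ℝ) 1, v ≠ 0 := fun v hv =>
    ne_zero_of_mem_unit_sphere ⟨v, hv⟩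
  have hcont : ContinuousOn (fun v : Fin n → ℝ => (v ⬝ᵥ M *ᵥ v) / ∑ i, v i ^ 2)
      (Metric.sphere 0 1) := by
    refine ContinuousOn.div (by fun_prop) (by fun_prop) fun v hv => ?_
    exact (sum_sq_pos_of_ne_zero (hne v hv)).ne'
  rcases n with _ | n
  · exact ⟨1, one_pos, fun v => by simp [dotProduct]⟩
  obtain ⟨u, hu, hmin⟩ := (isCompact_sphere (0 : Fin (n + 1) → ℝ) 1).exists_isMinOn
    (NormedSpace.sphere_nonempty.mpr zero_le_one) hcont
  refine ⟨_, div_pos (hq u (hne u hu)) (sum_sq_pos_of_ne_zero (hne u hu)), fun v => ?_⟩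
  rcases eq_or_ne v 0 with rfl | hv
  · simp
  have hv' : ‖v‖ ≠ 0 := norm_ne_zero_iff.mpr hv
  have h := hmin (show ‖v‖⁻¹ • v ∈ Metric.sphere (0 : Fin (n + 1) → ℝ) 1 by
    simp [norm_smul, hv'])
  rw [← le_div_iff₀ (sum_sq_pos_of_ne_zero hv)]
  refine h.trans_eq ?_
  simp only [mulVec_smul, smul_dotProduct, dotProduct_smul, Pi.smul_apply, smul_eq_mul, mul_pow,
    ← Finset.mul_sum]
  field_simp

lemma Matrix.PosDef.lambdaMin_pos {n : ℕ} (hn : 0 < n) {M : Matrix (Fin n) (Fin n) ℝ}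
    (hM : M.PosDef) : 0 < lambdaMin M := by
  obtain ⟨l, hl, h⟩ := hM.exists_pos_mul_sum_sq_le
  have : Nonempty (Fin n) := ⟨⟨0, hn⟩⟩
  refine hl.trans_le (le_csInf ?_ ?_)
  · have h1 : (1 : Fin n → ℝ) ≠ 0 := one_ne_zero
    exact ⟨_, 1, h1, (div_mul_cancel₀ _ (sum_sq_pos_of_ne_zero h1).ne').symm⟩
  · rintro r ⟨v, hv, hr⟩
    exact le_of_mul_le_mul_right (hr ▸ h v) (sum_sq_pos_of_ne_zero hv)

lemma Matrix.PosDef.lambdaMin_mul_le {n : ℕ} {M : Matrix (Fin n) (Fin n) ℝ}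
    (hM : M.PosDef) (v : Fin n → ℝ) : lambdaMin M * ∑ i, v i ^ 2 ≤ v ⬝ᵥ M *ᵥ v := by
  obtain ⟨l, hl, h⟩ := hM.exists_pos_mul_sum_sq_le
  rcases eq_or_ne v 0 with rfl | hv
  · simp
  rw [← le_div_iff₀ (sum_sq_pos_of_ne_zero hv)]
  refine csInf_le ⟨l, ?_⟩ ⟨v, hv, (div_mul_cancel₀ _ (sum_sq_pos_of_ne_zero hv).ne').symm⟩
  rintro r ⟨w, hw, hr⟩
  exact le_of_mul_le_mul_right (hr ▸ h w) (sum_sq_pos_of_ne_zero hw)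

lemma dotProduct_symPart_mulVec {n : ℕ} (M : Matrix (Fin n) (Fin n) ℝ) (v : Fin n → ℝ) :
    v ⬝ᵥ symPart M *ᵥ v = v ⬝ᵥ M *ᵥ v := by
  have h : v ⬝ᵥ Mᵀ *ᵥ v = v ⬝ᵥ M *ᵥ v := by
    rw [mulVec_transpose, dotProduct_comm, ← dotProduct_mulVec]
  rw [symPart, smul_mulVec, add_mulVec, dotProduct_smul, dotProduct_add, h, smul_eq_mul]
  ring

lemma Real.self_mul_sign_eq_abs (x : ℝ) : x * Real.sign x = |x| := by
  rcases lt_trichotomy x 0 with h | rfl | h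
  · simp [Real.sign_of_neg h, abs_of_neg h]
  · simp
  · simp [Real.sign_of_pos h, abs_of_pos h]

lemma signVec_neg {n : ℕ} (v : Fin n → ℝ) : signVec (-v) = -signVec v := by
  ext h
  simp [signVec, Real.sign_neg]

/-- The coupled error dynamics dissipate the quadratic form of `P`. -/
lemma RelaxedQUAD.dotProduct_coupled_le {n : ℕ}
    {f : (Fin n → ℝ) → ℝ → (Fin n → ℝ)} {P Q Γ Γd : Matrix (Fin n) (Fin n) ℝ}
    {m γd : Fin n → ℝ} {c cd : ℝ} (hf : RelaxedQUAD P Q m f)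
    (hPΓ : (symPart (P * Γ)).PosDef) (hPΓd : P * Γd = Matrix.diagonal γd)
    (hc : 0 ≤ c) (hcd : ∀ h, m h - 2 * cd * γd h ≤ 0) (x y : Fin n → ℝ) {t : ℝ} (ht : 0 ≤ t) :
    (x - y) ⬝ᵥ P *ᵥ ((f x t + c • Γ *ᵥ (y - x) + cd • Γd *ᵥ signVec (y - x))
      - (f y t + c • Γ *ᵥ (x - y) + cd • Γd *ᵥ signVec (x - y))) ≤
    -(2 * c * lambdaMin (symPart (P * Γ)) - specNorm Q) * ∑ i, (x - y) i ^ 2 := by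
  have hyx : y - x = -(x - y) := (neg_sub x y).symm
  have key : (x - y) ⬝ᵥ P *ᵥ ((f x t + c • Γ *ᵥ (y - x) + cd • Γd *ᵥ signVec (y - x))
      - (f y t + c • Γ *ᵥ (x - y) + cd • Γd *ᵥ signVec (x - y))) =
      (x - y) ⬝ᵥ P *ᵥ (f x t - f y t) - 2 * c * ((x - y) ⬝ᵥ (P * Γ) *ᵥ (x - y))
        - 2 * cd * ((x - y) ⬝ᵥ (P * Γd) *ᵥ signVec (x - y)) := by
    rw [hyx, signVec_neg]
    simp only [mulVec_neg, mulVec_sub, mulVec_add, mulVec_smul, ← mulVec_mulVec, dotProduct_sub,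
      dotProduct_add, dotProduct_smul, dotProduct_neg, smul_neg, smul_eq_mul]
    ring
  have hsign : (x - y) ⬝ᵥ (P * Γd) *ᵥ signVec (x - y) = ∑ h, γd h * |x h - y h| := by
    rw [hPΓd]
    refine Finset.sum_congr rfl fun h _ => ?_
    rw [mulVec_diagonal, signVec, ← Pi.sub_apply, ← Real.self_mul_sign_eq_abs]
    ring
  have hsum : ∑ h, m h * |x h - y h| ≤ 2 * cd * ∑ h, γd h * |x h - y h| := by
    rw [Finset.mul_sum]
    refine Finset.sum_le_sum fun h _ => ?_
    nlinarith [hcd h, abs_nonneg (x h - y h)]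
  have hΓ := hPΓ.lambdaMin_mul_le (x - y)
  rw [dotProduct_symPart_mulVec] at hΓ
  rw [key, hsign]
  nlinarith [hf x y t ht, dotProduct_mulVec_le_specNorm Q (x - y),
    mul_le_mul_of_nonneg_left hΓ hc]

namespace AbsolutelyContinuousOnInterval

lemma fun_sum {ι : Type*} (s : Finset ι) {g : ι → ℝ → ℝ} {a b : ℝ}
    (hg : ∀ i ∈ s, AbsolutelyContinuousOnInterval (g i) a b) :
    AbsolutelyContinuousOnInterval (fun t => ∑ i ∈ s, g i t) a b := by
  classical
  induction s using Finset.induction_on with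
  | empty =>
    simpa using (contDiff_const (c := (0 : ℝ))).contDiffOn.absolutelyContinuousOnInterval
  | insert i s hi ih =>
    simp only [Finset.sum_insert hi]
    exact (hg i (Finset.mem_insert_self i s)).fun_add
      (ih fun j hj => hg j (Finset.mem_insert_of_mem hj))

/-- Grönwall's inequality for a linear differential inequality holding almost everywhere. -/
lemma le_mul_exp_of_ae_hasDerivAt {V V' : ℝ → ℝ} {a T : ℝ} (hT : 0 ≤ T)
    (hV : AbsolutelyContinuousOnInterval V 0 T)
    (hd : ∀ᵐ t, t ∈ Set.uIcc 0 T → HasDerivAt V (V' t) t ∧ V' t ≤ -a * V t) :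
    V T ≤ V 0 * Real.exp (-a * T) := by
  have hexp : AbsolutelyContinuousOnInterval (fun t => Real.exp (a * t)) 0 T :=
    ContDiffOn.absolutelyContinuousOnInterval (by fun_prop)
  have hint := (hV.fun_mul hexp).integral_deriv_eq_sub
  have hnonpos : 0 ≤ ∫ t in (0 : ℝ)..T, -deriv (fun t => V t * Real.exp (a * t)) t := by
    refine intervalIntegral.integral_nonneg_of_ae_restrict hT ?_
    rw [Filter.EventuallyLE, ae_restrict_iff' measurableSet_Icc]
    filter_upwards [hd] with t ht htT
    obtain ⟨h1, h2⟩ := ht (by rwa [Set.uIcc_of_le hT])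
    have h3 : HasDerivAt (fun t => Real.exp (a * t)) (Real.exp (a * t) * (a * 1)) t :=
      ((hasDerivAt_id t).const_mul a).exp
    rw [(h1.fun_mul h3).deriv]
    simp only [Pi.zero_apply]
    nlinarith [Real.exp_pos (a * t)]
  rw [intervalIntegral.integral_neg, hint] at hnonpos
  have h : V T * Real.exp (a * T) ≤ V 0 := by simpa using hnonpos
  rwa [neg_mul, Real.exp_neg, ← div_eq_mul_inv, le_div_iff₀ (Real.exp_pos _)]

lemma dotProduct_mulVec {n : ℕ} (P : Matrix (Fin n) (Fin n) ℝ) {E : ℝ → Fin n → ℝ} {a b : ℝ}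
    (hE : ∀ i, AbsolutelyContinuousOnInterval (fun t => E t i) a b) :
    AbsolutelyContinuousOnInterval (fun t => E t ⬝ᵥ P *ᵥ E t) a b := by
  simp only [mulVec, dotProduct]
  exact fun_sum _ fun i _ => (hE i).fun_mul (fun_sum _ fun j _ => (hE j).const_mul (P i j))

end AbsolutelyContinuousOnInterval

lemma HasDerivAt.dotProduct_mulVec_self {n : ℕ} {P : Matrix (Fin n) (Fin n) ℝ} (hP : P.IsSymm)
    {E : ℝ → Fin n → ℝ} {E' : Fin n → ℝ} {t : ℝ} (hE : HasDerivAt E E' t) :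
    HasDerivAt (fun s => E s ⬝ᵥ P *ᵥ E s) (2 * (E t ⬝ᵥ P *ᵥ E')) t := by
  rw [hasDerivAt_pi] at hE
  have h : HasDerivAt (fun s => E s ⬝ᵥ P *ᵥ E s)
      (∑ i, (E' i * (P *ᵥ E t) i + E t i * (P *ᵥ E') i)) t := by
    simp only [mulVec, dotProduct]
    exact HasDerivAt.fun_sum fun i _ => (hE i).fun_mul
      (HasDerivAt.fun_sum fun j _ => (hE j).const_mul (P i j))
  convert h using 1
  have hsymm : E' ⬝ᵥ P *ᵥ E t = E t ⬝ᵥ P *ᵥ E' := by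
    rw [dotProduct_comm, ← hP.eq, mulVec_transpose, ← Matrix.dotProduct_mulVec, hP.eq]
  rw [Finset.sum_add_distrib]
  change _ = E' ⬝ᵥ P *ᵥ E t + E t ⬝ᵥ P *ᵥ E'
  rw [hsymm, two_mul]

/-- Exponential decay of a quadratic form along an absolutely continuous curve. -/
lemma dotProduct_mulVec_le_mul_exp_of_ae {n : ℕ} {P : Matrix (Fin n) (Fin n) ℝ} (hP : P.IsSymm)
    {e d : ℝ → Fin n → ℝ} {a T : ℝ} (hT : 0 ≤ T) (hd : IntervalIntegrable d volume 0 T)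
    (he : ∀ t ∈ Set.Icc 0 T, e t = e 0 + ∫ s in (0 : ℝ)..t, d s)
    (hdiss : ∀ᵐ t, t ∈ Set.Icc 0 T → 2 * (e t ⬝ᵥ P *ᵥ d t) ≤ -a * (e t ⬝ᵥ P *ᵥ e t)) :
    e T ⬝ᵥ P *ᵥ e T ≤ (e 0 ⬝ᵥ P *ᵥ e 0) * Real.exp (-a * T) := by
  have hdi : ∀ i, IntervalIntegrable (fun s => d s i) volume 0 T := fun i =>
    ⟨hd.1.eval i, hd.2.eval i⟩
  set E : ℝ → Fin n → ℝ := fun t i => e 0 i + ∫ s in (0 : ℝ)..t, d s i with hEdef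
  have hEe : ∀ t ∈ Set.Icc 0 T, E t = e t := fun t ht => by
    have hsub : Set.Ioc 0 t ⊆ Set.Ioc 0 T := Set.Ioc_subset_Ioc_right ht.2
    ext i
    rw [he t ht, Pi.add_apply, intervalIntegral.integral_of_le ht.1,
      eval_integral fun j => (hdi j).1.mono_set hsub, hEdef]
    simp only [intervalIntegral.integral_of_le ht.1]
  have hac : ∀ i, AbsolutelyContinuousOnInterval (fun t => E t i) 0 T := fun i =>
    AbsolutelyContinuousOnInterval.fun_add
      (contDiff_const.contDiffOn.absolutelyContinuousOnInterval)
      ((hdi i).absolutelyContinuousOnInterval_intervalIntegral Set.left_mem_uIcc)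
  have hV := (AbsolutelyContinuousOnInterval.dotProduct_mulVec P hac).le_mul_exp_of_ae_hasDerivAt
    (a := a) (V' := fun t => 2 * (E t ⬝ᵥ P *ᵥ d t)) hT (by
      filter_upwards [ae_all_iff.mpr fun i => (hdi i).ae_hasDerivAt_integral, hdiss]
        with t h1 h2 ht
      refine ⟨HasDerivAt.dotProduct_mulVec_self hP (hasDerivAt_pi.mpr fun i =>
        (h1 i ht 0 Set.left_mem_uIcc).const_add (e 0 i)), ?_⟩
      rw [Set.uIcc_of_le hT] at ht
      simpa only [hEe t ht] using h2 ht)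
  simpa only [hEe T ⟨hT, le_rfl⟩, hEe 0 ⟨le_rfl, hT⟩] using hV

/-- Two agents coupled by linear diffusion plus a discontinuous
(sign) coupling globally synchronize when `f` satisfies the relaxed QUAD condition,
`sym(PΓ) ≻ 0`, `PΓ_d = diag(γ_d) ⪰ 0` with `γ_{d,h} > 0` whenever `m_h > 0`,
`c > ‖Q‖ / (2 λ_min(sym(PΓ)))`, and `m_h − 2 c_d γ_{d,h} ≤ 0` for all `h`. -/
theorem two_agents_discontinuous_coupling_global_synchronization
    {n : ℕ} (hn : 0 < n)
    (f : (Fin n → ℝ) → ℝ → (Fin n → ℝ))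
    (P Q Γ Γd : Matrix (Fin n) (Fin n) ℝ)
    (m γd : Fin n → ℝ) (c cd : ℝ)
    (hP : P.PosDef) (hm : m ≠ 0)
    (hf : RelaxedQUAD P Q m f)
    (hPΓ : (symPart (P * Γ)).PosDef)
    (hPΓd : P * Γd = Matrix.diagonal γd)
    (hγd0 : ∀ h, 0 ≤ γd h) (hγdpos : ∀ h, 0 < m h → 0 < γd h)
    (hc : specNorm Q / (2 * lambdaMin (symPart (P * Γ))) < c)
    (hcd0 : 0 ≤ cd) (hcd : ∀ h, m h - 2 * cd * γd h ≤ 0)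
    (x1 x2 : ℝ → (Fin n → ℝ))
    (hx1 : ∃ d : ℝ → (Fin n → ℝ),
      (∀ t : ℝ, 0 ≤ t → IntervalIntegrable d volume 0 t) ∧
      (∀ᵐ t ∂(volume.restrict (Set.Ici (0 : ℝ))),
        d t = f (x1 t) t + c • Γ.mulVec (x2 t - x1 t)
            + cd • Γd.mulVec (signVec (x2 t - x1 t))) ∧
      (∀ t : ℝ, 0 ≤ t → x1 t = x1 0 + ∫ s in (0 : ℝ)..t, d s))
    (hx2 : ∃ d : ℝ → (Fin n → ℝ),
      (∀ t : ℝ, 0 ≤ t → IntervalIntegrable d volume 0 t) ∧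
      (∀ᵐ t ∂(volume.restrict (Set.Ici (0 : ℝ))),
        d t = f (x2 t) t + c • Γ.mulVec (x1 t - x2 t)
            + cd • Γd.mulVec (signVec (x1 t - x2 t))) ∧
      (∀ t : ℝ, 0 ≤ t → x2 t = x2 0 + ∫ s in (0 : ℝ)..t, d s)) :
    Filter.Tendsto (fun t => euclNorm (x1 t - x2 t)) Filter.atTop (nhds 0) := by
  have hl := hPΓ.lambdaMin_pos hn
  have hc0 : 0 < c := lt_of_le_of_lt (div_nonneg (specNorm_nonneg Q) (by positivity)) hc
  obtain ⟨d1, hd1, hode1, hint1⟩ := hx1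
  obtain ⟨d2, hd2, hode2, hint2⟩ := hx2
  set k := 2 * c * lambdaMin (symPart (P * Γ)) - specNorm Q with hk
  have hkpos : 0 < k := by
    rw [div_lt_iff₀ (by positivity)] at hc
    linarith
  obtain ⟨p, hp, hlow⟩ := hP.exists_pos_mul_sum_sq_le
  have hC : 0 < specNorm P + 1 := by linarith [specNorm_nonneg P]
  set a := 2 * k / (specNorm P + 1) with ha
  have hapos : 0 < a := by positivity
  have hsymm : P.IsSymm := by simpa using hP.isHermitian
  set V0 := (x1 0 - x2 0) ⬝ᵥ P *ᵥ (x1 0 - x2 0)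
  have hdecay : ∀ T : ℝ, 0 ≤ T →
      (x1 T - x2 T) ⬝ᵥ P *ᵥ (x1 T - x2 T) ≤ V0 * Real.exp (-a * T) := fun T hT => by
    refine dotProduct_mulVec_le_mul_exp_of_ae (e := fun t => x1 t - x2 t)
      (d := fun t => d1 t - d2 t) hsymm hT ((hd1 T hT).sub (hd2 T hT)) (fun t ht => ?_) ?_
    · rw [intervalIntegral.integral_sub (hd1 t ht.1) (hd2 t ht.1), hint1 t ht.1, hint2 t ht.1]
      abel
    · rw [ae_restrict_iff' measurableSet_Ici] at hode1 hode2
      filter_upwards [hode1, hode2] with t h1 h2 ht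
      rw [h1 ht.1, h2 ht.1]
      have hdiss := hf.dotProduct_coupled_le hPΓ hPΓd hc0.le hcd (x1 t) (x2 t) ht.1
      have hup := dotProduct_mulVec_le_specNorm P (x1 t - x2 t)
      have hnn : 0 ≤ ∑ i, (x1 t - x2 t) i ^ 2 := Finset.sum_nonneg fun _ _ => sq_nonneg _
      have hup' : a * ((x1 t - x2 t) ⬝ᵥ P *ᵥ (x1 t - x2 t)) ≤
          2 * k * ∑ i, (x1 t - x2 t) i ^ 2 := by
        calc _ ≤ a * ((specNorm P + 1) * ∑ i, (x1 t - x2 t) i ^ 2) :=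
              mul_le_mul_of_nonneg_left (by linarith) hapos.le
          _ = _ := by rw [ha]; field_simp
      linarith
  have hlim : Filter.Tendsto (fun T : ℝ => Real.sqrt (V0 * Real.exp (-a * T) / p))
      Filter.atTop (nhds 0) := by
    have h1 : Filter.Tendsto (fun T : ℝ => Real.exp (-a * T)) Filter.atTop (nhds 0) :=
      Real.tendsto_exp_atBot.comp
        (Filter.tendsto_id.const_mul_atTop_of_neg (neg_neg_of_pos hapos))
    simpa using ((h1.const_mul V0).div_const p).sqrt
  refine squeeze_zero' (.of_forall fun t => euclNorm_nonneg _) ?_ hlim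
  filter_upwards [Filter.eventually_ge_atTop 0] with T hT
  refine Real.sqrt_le_sqrt ?_
  rw [le_div_iff₀ hp, mul_comm]
  exact (hlow _).trans (hdecay T hT)
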